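/- arXiv:2406.09772 — 2 statements merged into one kernel-verified Lean document; each statement's English description precedes it below -/
import Mathlib

section
/- Suppose f is μ-strongly convex and L-smooth with minimizer x*. Let (x_k, y_k) be generated by the AOR-HB iteration with step size α = √(μ/L). Then there exists C₀ ≥ 0 depending only on (x₀, y₀, μ, L) such that f(x_{k+1}) − f(x*) + (μ/2)‖y_{k+1} − x*‖² ≤ C₀ (1 + (1/2)√(μ/L))^{−k} for all k ≥ 1. -/
open scoped RealInnerProductSpace

/-- The descent lemma: a function with `L`-Lipschitz gradient lies below its quadratic model. -/
theorem le_quadratic_model_of_lipschitz_gradient {E : Type*} [NormedAddCommGroup E]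
    [InnerProductSpace ℝ E] [CompleteSpace E] {f : E → ℝ} {f' : E → E} {L : ℝ}
    (hf : ∀ x, HasGradientAt f (f' x) x) (hsmooth : ∀ x y, ‖f' x - f' y‖ ≤ L * ‖x - y‖) (x y : E) :
    f y ≤ f x + ⟪f' x, y - x⟫ + L / 2 * ‖y - x‖ ^ 2 := by
  set v := y - x with hv
  have hderiv (t : ℝ) :
      HasDerivAt (fun t : ℝ ↦ f (x + t • v) - t * ⟪f' x, v⟫ - L / 2 * ‖v‖ ^ 2 * t ^ 2)
        (⟪f' (x + t • v), v⟫ - ⟪f' x, v⟫ - L * ‖v‖ ^ 2 * t) t := by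
    have hline : HasDerivAt (fun t : ℝ ↦ x + t • v) v t := by
      simpa using ((hasDerivAt_id t).smul_const v).const_add x
    have hcomp := (hf (x + t • v)).hasFDerivAt.comp_hasDerivAt t hline
    have hlin := (hasDerivAt_id t).mul_const ⟪f' x, v⟫
    have hquad := ((hasDerivAt_id t).pow 2).const_mul (L / 2 * ‖v‖ ^ 2)
    refine ((hcomp.sub hlin).sub hquad).congr_deriv ?_
    simp
    ring
  have hanti := antitoneOn_of_deriv_nonpos (convex_Icc (0 : ℝ) 1)
    (fun t _ ↦ (hderiv t).continuousAt.continuousWithinAt)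
    (fun t _ ↦ (hderiv t).differentiableAt.differentiableWithinAt) (fun t ht ↦ by
      rw [interior_Icc] at ht
      rw [(hderiv t).deriv, ← inner_sub_left]
      have hinner := real_inner_le_norm (f' (x + t • v) - f' x) v
      have hlip := hsmooth (x + t • v) x
      rw [add_sub_cancel_left, norm_smul, Real.norm_of_nonneg ht.1.le] at hlip
      nlinarith [mul_le_mul_of_nonneg_right hlip (norm_nonneg v)])
  have h := hanti (Set.left_mem_Icc.2 zero_le_one) (Set.right_mem_Icc.2 zero_le_one) zero_le_one
  simp only [one_smul, zero_smul, add_zero, hv, add_sub_cancel] at h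
  rw [← hv] at h
  linarith

/-- The Bregman divergence of a convex function with `L`-Lipschitz gradient dominates the squared
distance of the gradients. -/
theorem norm_sub_gradient_sq_le_bregman {E : Type*} [NormedAddCommGroup E]
    [InnerProductSpace ℝ E] [CompleteSpace E] {f : E → ℝ} {f' : E → E} {L : ℝ} (hL : 0 < L)
    (hf : ∀ x, HasGradientAt f (f' x) x) (hconv : ∀ x y, f x + ⟪f' x, y - x⟫ ≤ f y)
    (hsmooth : ∀ x y, ‖f' x - f' y‖ ≤ L * ‖x - y‖) (x y : E) :
    1 / (2 * L) * ‖f' y - f' x‖ ^ 2 ≤ f y - f x - ⟪f' x, y - x⟫ := by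
  set w := f' y - f' x with hw
  have hlower := hconv x (y - L⁻¹ • w)
  have hupper := le_quadratic_model_of_lipschitz_gradient hf hsmooth y (y - L⁻¹ • w)
  have hinner : ⟪f' y, w⟫ - ⟪f' x, w⟫ = ‖w‖ ^ 2 := by
    rw [← inner_sub_left, ← hw, real_inner_self_eq_norm_sq]
  rw [show y - L⁻¹ • w - x = (y - x) - L⁻¹ • w by abel, inner_sub_right,
    real_inner_smul_right] at hlower
  rw [show y - L⁻¹ • w - y = -(L⁻¹ • w) by abel, inner_neg_right, real_inner_smul_right,
    norm_neg, norm_smul, Real.norm_of_nonneg (inv_nonneg.2 hL.le)] at hupper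
  have hcoef : L / 2 * (L⁻¹ * ‖w‖) ^ 2 = 1 / (2 * L) * ‖w‖ ^ 2 := by
    field_simp
  have hhalf : L⁻¹ * ‖w‖ ^ 2 = 2 * (1 / (2 * L) * ‖w‖ ^ 2) := by
    field_simp
  have hscaled : L⁻¹ * ⟪f' y, w⟫ - L⁻¹ * ⟪f' x, w⟫ = L⁻¹ * ‖w‖ ^ 2 := by
    rw [← mul_sub, hinner]
  linarith

/-- Young's inequality for inner products, with weights adapted to `α ^ 2 * L = μ`. -/
theorem abs_mul_inner_le_of_sq_mul_eq {E : Type*} [NormedAddCommGroup E]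
    [InnerProductSpace ℝ E] {α μ L : ℝ} (hL : 0 < L) (hα : α ^ 2 * L = μ) (g v : E) :
    |α * ⟪g, v⟫| ≤ 1 / (2 * L) * ‖g‖ ^ 2 + μ / 2 * ‖v‖ ^ 2 := by
  have hexpand (s : ℝ) : 1 / (2 * L) * ‖g + (s * (α * L)) • v‖ ^ 2 =
      1 / (2 * L) * ‖g‖ ^ 2 + s * (α * ⟪g, v⟫) + s ^ 2 * (μ / 2 * ‖v‖ ^ 2) := by
    rw [norm_add_sq_real, real_inner_smul_right, norm_smul, mul_pow, Real.norm_eq_abs, sq_abs,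
      ← hα]
    field_simp
  have hplus : 0 ≤ 1 / (2 * L) * ‖g + (1 * (α * L)) • v‖ ^ 2 := by positivity
  have hminus : 0 ≤ 1 / (2 * L) * ‖g + (-1 * (α * L)) • v‖ ^ 2 := by positivity
  rw [hexpand] at hplus hminus
  rw [abs_le]
  constructor <;> linarith

/-- One AOR-HB step decreases the energy `f x - f xs + μ / 2 * ‖y - xs‖ ^ 2`, corrected by the cross
term `α * ⟪f' x, y - xs⟫`, by at least `α` times the energy at the new iterate. -/
theorem aorhb_energy_step {E : Type*} [NormedAddCommGroup E] [InnerProductSpace ℝ E]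
    {f : E → ℝ} {f' : E → E} {α μ L : ℝ} (hα₀ : 0 ≤ α) (hμ : μ ≠ 0) (hL : 0 < L)
    (hα : α ^ 2 * L = μ)
    (hsc : ∀ x y, f y - f x - ⟪f' x, y - x⟫ ≥ μ / 2 * ‖x - y‖ ^ 2)
    (hcoco : ∀ x y, 1 / (2 * L) * ‖f' y - f' x‖ ^ 2 ≤ f y - f x - ⟪f' x, y - x⟫)
    {xs x y x₁ y₁ : E} (hx : x₁ - x = α • (y - x₁))
    (hy : y₁ - y = α • (x₁ - y₁ - μ⁻¹ • ((2 : ℝ) • f' x₁ - f' x))) :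
    f x₁ - f xs + μ / 2 * ‖y₁ - xs‖ ^ 2 + α * ⟪f' x₁, y₁ - xs⟫
        + α * (f x₁ - f xs + μ / 2 * ‖y₁ - xs‖ ^ 2) ≤
      f x - f xs + μ / 2 * ‖y - xs‖ ^ 2 + α * ⟪f' x, y - xs⟫ := by
  have hbreg := hcoco x₁ x
  have hconv := hsc x₁ xs
  have hyoung := neg_le_of_abs_le (abs_mul_inner_le_of_sq_mul_eq hL hα (f' x₁ - f' x) (y₁ - y))
  have hpolar : ‖y - xs‖ ^ 2 = ‖y₁ - xs‖ ^ 2 - 2 * ⟪y₁ - xs, y₁ - y⟫ + ‖y₁ - y‖ ^ 2 := by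
    rw [← norm_sub_sq_real]
    congr 2
    abel
  have hcross : ‖x₁ - xs‖ ^ 2 =
      ‖y₁ - xs‖ ^ 2 + 2 * ⟪y₁ - xs, x₁ - y₁⟫ + ‖x₁ - y₁‖ ^ 2 := by
    rw [← norm_add_sq_real]
    congr 2
    abel
  have hxstep : ⟪f' x₁, x - x₁⟫ = -(α * ⟪f' x₁, y - x₁⟫) := by
    rw [← neg_sub x₁ x, hx, inner_neg_right, real_inner_smul_right]
  have hystep : μ * ⟪y₁ - xs, y₁ - y⟫ =
      α * (μ * ⟪y₁ - xs, x₁ - y₁⟫ - 2 * ⟪f' x₁, y₁ - xs⟫ + ⟪f' x, y₁ - xs⟫) := by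
    rw [hy, real_inner_smul_right, inner_sub_right _ (x₁ - y₁), real_inner_smul_right,
      inner_sub_right _ (_ • _), real_inner_smul_right, real_inner_comm (f' x₁), real_inner_comm (f' x)]
    field_simp
    ring
  rw [norm_sub_rev (f' x)] at hbreg
  have hmu : 0 ≤ μ := hα ▸ by positivity
  have hdrop : 0 ≤ α * (μ * ‖x₁ - y₁‖ ^ 2) := by positivity
  have hdecay := mul_le_mul_of_nonneg_left hconv hα₀
  rw [hcross] at hdecay
  rw [hpolar]
  have hsplit : ⟪f' x₁ - f' x, y₁ - y⟫ = ⟪f' x₁, y₁ - xs⟫ - ⟪f' x₁, y - xs⟫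
      - ⟪f' x, y₁ - xs⟫ + ⟪f' x, y - xs⟫ := by
    simp only [inner_sub_left, inner_sub_right]
    ring
  have hshift : ⟪f' x₁, y - x₁⟫ = ⟪f' x₁, y - xs⟫ + ⟪f' x₁, xs - x₁⟫ := by
    simp only [inner_sub_right]
    ring
  rw [hsplit] at hyoung
  rw [hxstep, hshift] at hbreg
  linarith

/-- Accelerated global linear convergence of the AOR-HB method (Theorem 1):
`f(x_{k+1}) − f(x*) + (μ/2)‖y_{k+1} − x*‖² ≤ C₀ (1 + √(μ/L)/2)^{−k}` for `k ≥ 1`. -/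
theorem aorhb_accelerated_convergence {d : ℕ}
    (f : EuclideanSpace ℝ (Fin d) → ℝ) (f' : EuclideanSpace ℝ (Fin d) → EuclideanSpace ℝ (Fin d))
    (μ L : ℝ) (hμ : 0 < μ) (hμL : μ ≤ L)
    (hf : ∀ x, HasGradientAt f (f' x) x)
    (hsc : ∀ x y, f y - f x - ⟪f' x, y - x⟫ ≥ μ / 2 * ‖x - y‖ ^ 2)
    (hsmooth : ∀ x y, ‖f' x - f' y‖ ≤ L * ‖x - y‖)
    (xs : EuclideanSpace ℝ (Fin d)) (hmin : ∀ z, f xs ≤ f z)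
    (α : ℝ) (hα : α = Real.sqrt (μ / L))
    (x y : ℕ → EuclideanSpace ℝ (Fin d))
    (hx : ∀ k, x (k + 1) - x k = α • (y k - x (k + 1)))
    (hy : ∀ k, y (k + 1) - y k =
      α • (x (k + 1) - y (k + 1) - μ⁻¹ • ((2 : ℝ) • f' (x (k + 1)) - f' (x k)))) :
    ∃ C₀ : ℝ, 0 ≤ C₀ ∧ ∀ k : ℕ, 1 ≤ k →
      f (x (k + 1)) - f xs + μ / 2 * ‖y (k + 1) - xs‖ ^ 2 ≤
        C₀ * ((1 + (1 / 2) * Real.sqrt (μ / L))⁻¹) ^ k := by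
  have hL : 0 < L := hμ.trans_le hμL
  have hα₀ : 0 < α := hα ▸ Real.sqrt_pos.2 (div_pos hμ hL)
  have hαL : α ^ 2 * L = μ := by
    rw [hα, Real.sq_sqrt (div_pos hμ hL).le, div_mul_cancel₀ _ hL.ne']
  have hcoco := norm_sub_gradient_sq_le_bregman hL hf
    (fun x y ↦ by nlinarith [hsc x y, sq_nonneg ‖x - y‖]) hsmooth
  have hgrad : f' xs = 0 := by
    have hfderiv := IsLocalMin.hasFDerivAt_eq_zero (Filter.Eventually.of_forall hmin)
      (hf xs).hasFDerivAt
    simpa using hfderiv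
  rw [← hα]
  set e : ℕ → ℝ := fun k ↦ f (x k) - f xs + μ / 2 * ‖y k - xs‖ ^ 2 with he
  set V : ℕ → ℝ := fun k ↦ e k + α * ⟪f' (x k), y k - xs⟫ with hV
  have hcross (k : ℕ) : |α * ⟪f' (x k), y k - xs⟫| ≤ e k := by
    have hgap := hcoco xs (x k)
    rw [hgrad, sub_zero, inner_zero_left, sub_zero] at hgap
    exact (abs_mul_inner_le_of_sq_mul_eq hL hαL _ _).trans (by simp only [he]; linarith)
  have hstep (k : ℕ) : V (k + 1) + α * e (k + 1) ≤ V k :=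
    aorhb_energy_step hα₀.le hμ.ne' hL hαL hsc hcoco (hx k) (hy k)
  have hV₀ (k : ℕ) : 0 ≤ V k := by
    linarith [neg_le_of_abs_le (hcross k)]
  have hVe (k : ℕ) : V k ≤ 2 * e k := by
    linarith [le_of_abs_le (hcross k)]
  have hdecay (k : ℕ) : V k ≤ V 0 * ((1 + (1 / 2) * α)⁻¹) ^ k := by
    induction k with
    | zero => simp
    | succ k ih =>
      rw [pow_succ, ← mul_assoc, ← div_eq_mul_inv, le_div_iff₀ (by positivity)]
      nlinarith [hstep k, mul_le_mul_of_nonneg_left (hVe (k + 1)) hα₀.le]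
  refine ⟨V 0 / α, div_nonneg (hV₀ 0) hα₀.le, fun k _ ↦ ?_⟩
  change e (k + 1) ≤ _
  rw [div_mul_eq_mul_div, le_div_iff₀ hα₀]
  linarith [hstep k, hV₀ (k + 1), hdecay k]
end

section
/- Let f be μ_f-strongly convex/L_f-smooth and g be μ_g-strongly convex/L_g-smooth, with saddle point (u*,p*) of L(u,p) = f(u) − g(p) + ⟨Bu,p⟩. Let (u_k, v_k, p_k, q_k) be generated by the AOR-HB-saddle-I scheme with step size α = min{√(μ_f/L_f), √(μ_g/L_g)}. Then there exists C₀ ≥ 0 depending on the initial data and (μ_f, L_f, μ_g, L_g) such that D_f(u_{k+1}, u*) + D_g(p_{k+1}, p*) + (μ_f/2)‖v_{k+1} − u*‖² + (μ_g/2)‖q_{k+1} − p*‖² ≤ C₀ (1 + α/2)^{−k} for all k ≥ 1. -/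
open scoped RealInnerProductSpace

section

variable {E : Type*} [NormedAddCommGroup E] [InnerProductSpace ℝ E]

/-- The Bregman divergence `D_f(y, x)` of a function `f` with gradient `f'`. -/
def bregman (f : E → ℝ) (f' : E → E) (y x : E) : ℝ := f y - f x - ⟪f' x, y - x⟫

lemma bregman_le_of_lipschitz_gradient [CompleteSpace E] {f : E → ℝ} {f' : E → E} {L : ℝ}
    (hf : ∀ x, HasGradientAt f (f' x) x) (hL : ∀ x y, ‖f' x - f' y‖ ≤ L * ‖x - y‖) (x y : E) :
    bregman f f' y x ≤ L / 2 * ‖y - x‖ ^ 2 := by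
  set d := y - x with hd
  let φ : ℝ → ℝ := fun t => f (x + t • d) - t * ⟪f' x, d⟫ - L / 2 * t ^ 2 * ‖d‖ ^ 2
  have hφ : ∀ t, HasDerivAt φ (⟪f' (x + t • d), d⟫ - ⟪f' x, d⟫ - L * t * ‖d‖ ^ 2) t := by
    intro t
    have hline : HasDerivAt (fun t : ℝ => x + t • d) d t := by
      simpa using ((hasDerivAt_id t).smul_const d).const_add x
    have hcomp : HasDerivAt (fun t : ℝ => f (x + t • d)) ⟪f' (x + t • d), d⟫ t := by
      simpa [Function.comp_def] using (hf (x + t • d)).hasFDerivAt.comp_hasDerivAt t hline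
    have hlin : HasDerivAt (fun t : ℝ => t * ⟪f' x, d⟫) ⟪f' x, d⟫ t := by
      simpa using (hasDerivAt_id t).mul_const ⟪f' x, d⟫
    have hquad : HasDerivAt (fun t : ℝ => L / 2 * t ^ 2 * ‖d‖ ^ 2) (L * t * ‖d‖ ^ 2) t := by
      refine ((((hasDerivAt_id t).pow 2).const_mul (L / 2)).mul_const (‖d‖ ^ 2)).congr_deriv ?_
      simp only [id_eq]
      ring
    exact (hcomp.sub hlin).sub hquad
  have hanti : AntitoneOn φ (Set.Icc 0 1) := by
    refine antitoneOn_of_deriv_nonpos (convex_Icc 0 1)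
      (fun t _ => (hφ t).continuousAt.continuousWithinAt)
      (fun t _ => (hφ t).differentiableAt.differentiableWithinAt) fun t ht => ?_
    rw [interior_Icc] at ht
    rw [(hφ t).deriv, ← inner_sub_left]
    have hinner := real_inner_le_norm (f' (x + t • d) - f' x) d
    have hlip := hL (x + t • d) x
    rw [add_sub_cancel_left, norm_smul, Real.norm_of_nonneg ht.1.le] at hlip
    nlinarith [mul_le_mul_of_nonneg_right hlip (norm_nonneg d)]
  have h := hanti (Set.left_mem_Icc.2 zero_le_one) (Set.right_mem_Icc.2 zero_le_one) zero_le_one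
  simp only [φ, one_smul, zero_smul, add_zero] at h
  rw [show x + d = y by simp [hd]] at h
  simp only [bregman, ← hd]
  linarith

lemma norm_gradient_sub_sq_le_bregman [CompleteSpace E] {f : E → ℝ} {f' : E → E} {L : ℝ}
    (hL0 : 0 < L) (hf : ∀ x, HasGradientAt f (f' x) x)
    (hL : ∀ x y, ‖f' x - f' y‖ ≤ L * ‖x - y‖) (hconv : ∀ x y, 0 ≤ bregman f f' y x) (x y : E) :
    1 / (2 * L) * ‖f' y - f' x‖ ^ 2 ≤ bregman f f' y x := by
  have h₁ := hconv x (y - L⁻¹ • (f' y - f' x))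
  have h₂ := bregman_le_of_lipschitz_gradient hf hL y (y - L⁻¹ • (f' y - f' x))
  have h₃ : ⟪f' y, f' y - f' x⟫ - ⟪f' x, f' y - f' x⟫ = ‖f' y - f' x‖ ^ 2 := by
    rw [← inner_sub_left, real_inner_self_eq_norm_sq]
  have h₄ : y - L⁻¹ • (f' y - f' x) - y = -(L⁻¹ • (f' y - f' x)) := by abel
  have h₅ : y - L⁻¹ • (f' y - f' x) - x = (y - x) - L⁻¹ • (f' y - f' x) := by abel
  simp only [bregman] at *
  rw [h₄, norm_neg, norm_smul, Real.norm_of_nonneg (inv_pos.2 hL0).le, inner_neg_right,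
    inner_smul_right] at h₂
  rw [h₅, inner_sub_right, inner_smul_right] at h₁
  have h₆ : L / 2 * (L⁻¹ * ‖f' y - f' x‖) ^ 2 = L⁻¹ / 2 * ‖f' y - f' x‖ ^ 2 := by
    field_simp
  have h₇ : 1 / (2 * L) = L⁻¹ / 2 := by field_simp
  rw [h₆] at h₂
  rw [h₇]
  linear_combination h₁ + h₂ - L⁻¹ * h₃

/-- Young's inequality weighted for a step size `α ≤ √(μ / L)`. -/
lemma abs_mul_inner_le_of_sq_mul_le {μ L α : ℝ} (hL : 0 < L) (hα : 0 ≤ α)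
    (hαL : α ^ 2 * L ≤ μ) (x y : E) :
    |α * ⟪x, y⟫| ≤ 1 / (2 * L) * ‖x‖ ^ 2 + μ / 2 * ‖y‖ ^ 2 := by
  have hxy := abs_real_inner_le_norm x y
  have hsq := sq_nonneg (‖x‖ - α * L * ‖y‖)
  have hy := mul_le_mul_of_nonneg_right hαL (sq_nonneg ‖y‖)
  have key : α * (‖x‖ * ‖y‖) ≤ 1 / (2 * L) * ‖x‖ ^ 2 + α ^ 2 * L / 2 * ‖y‖ ^ 2 := by
    have : 1 / (2 * L) * ‖x‖ ^ 2 + α ^ 2 * L / 2 * ‖y‖ ^ 2 - α * (‖x‖ * ‖y‖)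
        = 1 / (2 * L) * (‖x‖ - α * L * ‖y‖) ^ 2 := by
      field_simp
      ring
    have : 0 ≤ 1 / (2 * L) * (‖x‖ - α * L * ‖y‖) ^ 2 := by positivity
    linarith
  rw [abs_mul, abs_of_nonneg hα]
  linarith [mul_le_mul_of_nonneg_left hxy hα]

/-- The Lyapunov function `D_f(u, u*) + μ / 2 * ‖v - u*‖²`. -/
noncomputable def lyapunov (f : E → ℝ) (f' : E → E) (μ : ℝ) (us u v : E) : ℝ :=
  bregman f f' u us + μ / 2 * ‖v - us‖ ^ 2

/-- The cross term `⟪∇f(u) - ∇f(u*), v - u*⟫`. -/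
def crossTerm (f' : E → E) (us u v : E) : ℝ := ⟪f' u - f' us, v - us⟫

lemma abs_mul_crossTerm_le_lyapunov [CompleteSpace E] {f : E → ℝ} {f' : E → E} {μ L α : ℝ}
    (hL0 : 0 < L) (hf : ∀ x, HasGradientAt f (f' x) x)
    (hL : ∀ x y, ‖f' x - f' y‖ ≤ L * ‖x - y‖) (hconv : ∀ x y, 0 ≤ bregman f f' y x)
    (hα : 0 ≤ α) (hαL : α ^ 2 * L ≤ μ) (us u v : E) :
    |α * crossTerm f' us u v| ≤ lyapunov f f' μ us u v := by
  have h₁ := abs_mul_inner_le_of_sq_mul_le hL0 hα hαL (f' u - f' us) (v - us)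
  have h₂ := norm_gradient_sub_sq_le_bregman hL0 hf hL hconv us u
  unfold crossTerm lyapunov
  linarith

lemma lyapunov_step [CompleteSpace E] {f : E → ℝ} {f' : E → E} {μ L α : ℝ}
    (hμ : 0 < μ) (hL0 : 0 < L) (hf : ∀ x, HasGradientAt f (f' x) x)
    (hL : ∀ x y, ‖f' x - f' y‖ ≤ L * ‖x - y‖)
    (hsc : ∀ x y, μ / 2 * ‖x - y‖ ^ 2 ≤ bregman f f' y x)
    (hα : 0 ≤ α) (hαL : α ^ 2 * L ≤ μ) {us u v u' v' w : E}
    (hu : u' = (1 + α)⁻¹ • (u + α • v))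
    (hv : v' = (1 + α)⁻¹ •
      (v + α • u' - (α / μ) • ((2 : ℝ) • f' u' - f' u - f' us + w))) :
    (1 + α) * lyapunov f f' μ us u' v' + α * crossTerm f' us u' v' + α * ⟪w, v' - us⟫ ≤
      lyapunov f f' μ us u v + α * crossTerm f' us u v := by
  have hα1 : (1 + α) ≠ 0 := by positivity
  have hconv : ∀ x y, 0 ≤ bregman f f' y x := fun x y => le_trans (by positivity) (hsc x y)
  have hu₁ : u' - u = α • (v - u') := by
    have : (1 + α) • u' = u + α • v := by rw [hu, smul_inv_smul₀ hα1]
    rw [add_smul, one_smul] at this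
    rw [smul_sub, sub_eq_sub_iff_add_eq_add, this, add_comm]
  have hv₁ : μ • (v' - v) =
      (μ * α) • (u' - v') - α • ((2 : ℝ) • f' u' - f' u - f' us + w) := by
    have h : (1 + α) • v' =
        v + α • u' - (α / μ) • ((2 : ℝ) • f' u' - f' u - f' us + w) := by
      rw [hv, smul_inv_smul₀ hα1]
    have h' : v' - v = α • (u' - v') - (α / μ) • ((2 : ℝ) • f' u' - f' u - f' us + w) := by
      rw [add_smul, one_smul] at h
      rw [smul_sub, ← sub_eq_zero, ← sub_eq_zero.2 h]
      abel
    rw [h', smul_sub, smul_smul, smul_smul, mul_div_cancel₀ _ hμ.ne']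
  have hco := norm_gradient_sub_sq_le_bregman hL0 hf hL hconv u' u
  have hyoung := (abs_le.1 (abs_mul_inner_le_of_sq_mul_le hL0 hα hαL (f' u - f' u') (v' - v))).2
  have hscs := mul_le_mul_of_nonneg_left (hsc u' us) hα
  have hsq : 0 ≤ α * μ / 2 * ‖u' - v'‖ ^ 2 := by positivity
  have hiu := congrArg (fun z => ⟪f' u' - f' us, z⟫) hu₁
  have hiv := congrArg (fun z => ⟪z, v' - us⟫) hv₁
  -- Express every vector through differences from `us`.
  obtain ⟨a, ha⟩ : ∃ a, a = u - us := ⟨_, rfl⟩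
  obtain ⟨b, hb⟩ : ∃ b, b = v - us := ⟨_, rfl⟩
  obtain ⟨c, hc⟩ : ∃ c, c = u' - us := ⟨_, rfl⟩
  obtain ⟨d, hd⟩ : ∃ d, d = v' - us := ⟨_, rfl⟩
  simp only [lyapunov, crossTerm, bregman] at *
  rw [show u' - u = c - a by rw [hc, ha]; abel, show v - u' = b - c by rw [hb, hc]; abel] at hiu
  rw [show v' - v = d - b by rw [hd, hb]; abel, show u' - v' = c - d by rw [hc, hd]; abel,
    ← hd] at hiv
  rw [show u - u' = a - c by rw [hc, ha]; abel] at hco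
  rw [show v' - v = d - b by rw [hd, hb]; abel] at hyoung
  rw [show u' - v' = c - d by rw [hc, hd]; abel] at hsq
  rw [← hc, show us - u' = -c by rw [hc]; abel] at hscs
  rw [← ha, ← hb, ← hc, ← hd]
  rw [norm_sub_sq_real d b] at hyoung
  rw [norm_sub_sq_real c d] at hsq
  have hcomm := real_inner_comm b d
  simp only [inner_sub_left, inner_sub_right, inner_add_left, inner_neg_right,
    real_inner_smul_left, inner_smul_right, real_inner_self_eq_norm_sq] at hiu hiv hco hyoung hscs ⊢
  linear_combination hiu + hiv + hco + hyoung + hscs + hsq - μ * hcomm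

end

open scoped RealInnerProductSpace

/-- Accelerated linear convergence of the AOR-HB-saddle-I scheme with step size
`α = min{√(μ_f/L_f), √(μ_g/L_g)}` (Theorem on AOR-HB-saddle-I). -/
theorem aorhb_saddle_I_convergence {m n : ℕ}
    (f : EuclideanSpace ℝ (Fin m) → ℝ) (f' : EuclideanSpace ℝ (Fin m) → EuclideanSpace ℝ (Fin m))
    (g : EuclideanSpace ℝ (Fin n) → ℝ) (g' : EuclideanSpace ℝ (Fin n) → EuclideanSpace ℝ (Fin n))
    (μf Lf μg Lg : ℝ) (hμf : 0 < μf) (hμg : 0 < μg) (hμLf : μf ≤ Lf) (hμLg : μg ≤ Lg)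
    (hf : ∀ x, HasGradientAt f (f' x) x)
    (hg : ∀ x, HasGradientAt g (g' x) x)
    (hfsc : ∀ x y, f y - f x - ⟪f' x, y - x⟫ ≥ μf / 2 * ‖x - y‖ ^ 2)
    (hgsc : ∀ x y, g y - g x - ⟪g' x, y - x⟫ ≥ μg / 2 * ‖x - y‖ ^ 2)
    (hfsmooth : ∀ x y, ‖f' x - f' y‖ ≤ Lf * ‖x - y‖)
    (hgsmooth : ∀ x y, ‖g' x - g' y‖ ≤ Lg * ‖x - y‖)
    (B : EuclideanSpace ℝ (Fin m) →ₗ[ℝ] EuclideanSpace ℝ (Fin n))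
    (Bt : EuclideanSpace ℝ (Fin n) →ₗ[ℝ] EuclideanSpace ℝ (Fin m))
    (hBt : ∀ u p, ⟪B u, p⟫ = ⟪u, Bt p⟫)
    (us : EuclideanSpace ℝ (Fin m)) (ps : EuclideanSpace ℝ (Fin n))
    (hsaddle1 : f' us + Bt ps = 0) (hsaddle2 : g' ps - B us = 0)
    (α : ℝ) (hα : α = min (Real.sqrt (μf / Lf)) (Real.sqrt (μg / Lg)))
    (u v : ℕ → EuclideanSpace ℝ (Fin m)) (p q : ℕ → EuclideanSpace ℝ (Fin n))
    (hu : ∀ k, u (k + 1) = (1 + α)⁻¹ • (u k + α • v k))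
    (hp : ∀ k, p (k + 1) = (1 + α)⁻¹ • (p k + α • q k))
    (hv : ∀ k, v (k + 1) = (1 + α)⁻¹ •
      (v k + α • u (k + 1) -
        (α / μf) • ((2 : ℝ) • f' (u (k + 1)) - f' (u k) + Bt (q (k + 1)))))
    (hq : ∀ k, q (k + 1) = (1 + α)⁻¹ •
      (q k + α • p (k + 1) -
        (α / μg) • ((2 : ℝ) • g' (p (k + 1)) - g' (p k) - B (v (k + 1))))) :
    ∃ C₀ : ℝ, 0 ≤ C₀ ∧ ∀ k : ℕ, 1 ≤ k →
      (f (u (k + 1)) - f us - ⟪f' us, u (k + 1) - us⟫) +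
        (g (p (k + 1)) - g ps - ⟪g' ps, p (k + 1) - ps⟫) +
        μf / 2 * ‖v (k + 1) - us‖ ^ 2 + μg / 2 * ‖q (k + 1) - ps‖ ^ 2 ≤
      C₀ * ((1 + α / 2)⁻¹) ^ k := by
  have hLf : 0 < Lf := hμf.trans_le hμLf
  have hLg : 0 < Lg := hμg.trans_le hμLg
  have hα0 : 0 < α := by
    rw [hα]
    exact lt_min (Real.sqrt_pos.2 (by positivity)) (Real.sqrt_pos.2 (by positivity))
  have hαf : α ^ 2 * Lf ≤ μf := by
    rw [← le_div_iff₀ hLf, ← Real.le_sqrt hα0.le (by positivity), hα]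
    exact min_le_left _ _
  have hαg : α ^ 2 * Lg ≤ μg := by
    rw [← le_div_iff₀ hLg, ← Real.le_sqrt hα0.le (by positivity), hα]
    exact min_le_right _ _
  have hfsc' : ∀ x y, μf / 2 * ‖x - y‖ ^ 2 ≤ bregman f f' y x := hfsc
  have hgsc' : ∀ x y, μg / 2 * ‖x - y‖ ^ 2 ≤ bregman g g' y x := hgsc
  have hfconv : ∀ x y, 0 ≤ bregman f f' y x := fun x y => le_trans (by positivity) (hfsc' x y)
  have hgconv : ∀ x y, 0 ≤ bregman g g' y x := fun x y => le_trans (by positivity) (hgsc' x y)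
  let energy : ℕ → ℝ := fun k =>
    lyapunov f f' μf us (u k) (v k) + lyapunov g g' μg ps (p k) (q k)
  let cross : ℕ → ℝ := fun k => crossTerm f' us (u k) (v k) + crossTerm g' ps (p k) (q k)
  have hcross : ∀ k, |α * cross k| ≤ energy k := by
    intro k
    have h₁ := abs_mul_crossTerm_le_lyapunov hLf hf hfsmooth hfconv hα0.le hαf us (u k) (v k)
    have h₂ := abs_mul_crossTerm_le_lyapunov hLg hg hgsmooth hgconv hα0.le hαg ps (p k) (q k)
    simp only [cross, energy, mul_add]
    exact (abs_add_le _ _).trans (add_le_add h₁ h₂)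
  have hstep : ∀ k, (1 + α) * energy (k + 1) + α * cross (k + 1) ≤ energy k + α * cross k := by
    intro k
    have hBt_us : f' us = -Bt ps := eq_neg_of_add_eq_zero_left hsaddle1
    have hB_us : g' ps = B us := sub_eq_zero.1 hsaddle2
    have h₁ := lyapunov_step (us := us) (v' := v (k + 1)) (w := Bt (q (k + 1) - ps)) hμf hLf hf hfsmooth hfsc'
      hα0.le hαf (hu k) (by rw [hv k, hBt_us, map_sub]; congr 3; abel)
    have h₂ := lyapunov_step (us := ps) (v' := q (k + 1)) (w := -B (v (k + 1) - us)) hμg hLg hg hgsmooth hgsc'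
      hα0.le hαg (hp k) (by rw [hq k, hB_us, map_sub]; congr 3; abel)
    have hcancel : ⟪Bt (q (k + 1) - ps), v (k + 1) - us⟫ +
        ⟪-B (v (k + 1) - us), q (k + 1) - ps⟫ = 0 := by
      rw [inner_neg_left, hBt, real_inner_comm, add_neg_cancel]
    simp only [energy, cross]
    linear_combination h₁ + h₂ - α * hcancel
  have hdecay : ∀ k, energy k + α * cross k ≤
      (energy 0 + α * cross 0) * ((1 + α / 2)⁻¹) ^ k := by
    intro k
    induction k with
    | zero => simp
    | succ k ih =>
      have hbound := (abs_le.1 (hcross (k + 1))).2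
      rw [pow_succ, ← mul_assoc, ← div_eq_mul_inv, le_div_iff₀ (by positivity)]
      nlinarith [hstep k]
  have hnonneg : ∀ k, 0 ≤ energy k + α * cross k := fun k => by
    linarith [(abs_le.1 (hcross k)).1]
  refine ⟨(energy 0 + α * cross 0) / α, div_nonneg (hnonneg 0) hα0.le, fun k _ => ?_⟩
  have hbound : energy (k + 1) ≤ (energy 0 + α * cross 0) / α * ((1 + α / 2)⁻¹) ^ k := by
    rw [div_mul_eq_mul_div, le_div_iff₀ hα0]
    linarith [hstep k, hnonneg (k + 1), hdecay k]
  refine le_trans (le_of_eq ?_) hbound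
  simp only [energy, lyapunov, bregman]
  ring
end
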